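/- arXiv:1610.01499 — 12 statements merged into one kernel-verified Lean document; each statement's English description precedes it below -/
import Mathlib

section
/- Let (a_n)_{n≥0} and (c_n)_{n≥0} be real sequences with a_n ≠ 0 for all n, and consider the recurrence x_{n+1} = a_n x_n/(c_n x_n + 1). For a real number x, a solution (x_n)_{n≥0} with x_0 = x exists if and only if for every n ≥ 1, x·(Σ_{i=0}^{n−1} c_i ∏_{j=0}^{i−1} a_j) + 1 ≠ 0; equivalently, the forbidden set of this equation is { −(Σ_{i=0}^{n−1} c_i ∏_{j=0}^{i−1} a_j)^{−1} : n ≥ 1 and Σ_{i=0}^{n−1} c_i ∏_{j=0}^{i−1} a_j ≠ 0 }. -/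
/-- `(x_n)` is a solution of `x_{n+1} = a_n x_n / (c_n x_n + 1)`. -/
def IsSol (a c : ℕ → ℝ) (x : ℕ → ℝ) : Prop :=
  ∀ n, c n * x n + 1 ≠ 0 ∧ x (n + 1) = a n * x n / (c n * x n + 1)

theorem sol_aux (a c : ℕ → ℝ) (x : ℝ) :
    (∃ xs : ℕ → ℝ, IsSol a c xs ∧ xs 0 = x) ↔
      ∀ n ≥ 1, x * (∑ i ∈ Finset.range n, c i * ∏ j ∈ Finset.range i, a j) + 1 ≠ 0 := by
  constructor
  · rintro ⟨xs, h, h0⟩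
    have key : ∀ n, x * (∑ i ∈ Finset.range n, c i * ∏ j ∈ Finset.range i, a j) + 1 ≠ 0 ∧
        xs n * (x * (∑ i ∈ Finset.range n, c i * ∏ j ∈ Finset.range i, a j) + 1)
          = (∏ j ∈ Finset.range n, a j) * x := by
      intro n
      induction n with
      | zero => simp [h0]
      | succ n ih =>
        obtain ⟨h1, h2⟩ := ih
        obtain ⟨h3, h4⟩ := h n
        rw [Finset.sum_range_succ, Finset.prod_range_succ, h4]
        generalize (∑ i ∈ Finset.range n, c i * ∏ j ∈ Finset.range i, a j) = S at *
        generalize (∏ j ∈ Finset.range n, a j) = P at *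
        have e : x * (S + c n * P) + 1 = (x * S + 1) * (c n * xs n + 1) := by
          linear_combination (-c n) * h2
        rw [e]
        refine ⟨mul_ne_zero h1 h3, ?_⟩
        rw [mul_comm (x * S + 1), ← mul_assoc, div_mul_cancel₀ _ h3]
        linear_combination a n * h2
    exact fun n _ => (key n).1
  · intro h
    have h' : ∀ n, x * (∑ i ∈ Finset.range n, c i * ∏ j ∈ Finset.range i, a j) + 1 ≠ 0 := by
      intro n
      rcases Nat.eq_zero_or_pos n with rfl | hn
      · simp
      · exact h n hn
    refine ⟨fun n => (∏ j ∈ Finset.range n, a j) * x /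
      (x * (∑ i ∈ Finset.range n, c i * ∏ j ∈ Finset.range i, a j) + 1), ?_, by simp⟩
    intro n
    have h1 := h' n
    have h2 := h' (n + 1)
    simp only
    rw [Finset.sum_range_succ] at h2 ⊢
    rw [Finset.prod_range_succ]
    generalize (∑ i ∈ Finset.range n, c i * ∏ j ∈ Finset.range i, a j) = S at *
    generalize (∏ j ∈ Finset.range n, a j) = P at *
    have e : c n * (P * x / (x * S + 1)) + 1 = (x * (S + c n * P) + 1) / (x * S + 1) := by
      rw [eq_div_iff h1, add_mul, mul_assoc, div_mul_cancel₀ _ h1]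
      ring
    rw [e]
    refine ⟨div_ne_zero h2 h1, ?_⟩
    rw [div_eq_div_iff h2 (div_ne_zero h2 h1), mul_div_assoc', mul_div_assoc', div_mul_eq_mul_div]
    congr 1
    ring

/-- existence criterion and forbidden set for
`x_{n+1} = a_n x_n / (c_n x_n + 1)`. -/
theorem stmt4 (a c : ℕ → ℝ) (ha : ∀ n, a n ≠ 0) (x : ℝ) :
    ((∃ xs : ℕ → ℝ, IsSol a c xs ∧ xs 0 = x) ↔
      ∀ n ≥ 1, x * (∑ i ∈ Finset.range n, c i * ∏ j ∈ Finset.range i, a j) + 1 ≠ 0) ∧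
    ((¬ ∃ xs : ℕ → ℝ, IsSol a c xs ∧ xs 0 = x) ↔
      ∃ n ≥ 1, (∑ i ∈ Finset.range n, c i * ∏ j ∈ Finset.range i, a j) ≠ 0 ∧
        x = -(∑ i ∈ Finset.range n, c i * ∏ j ∈ Finset.range i, a j)⁻¹) := by
  refine ⟨sol_aux a c x, ?_⟩
  rw [sol_aux a c x]
  push Not
  refine exists_congr fun n => and_congr_right fun _ => ?_
  generalize (∑ i ∈ Finset.range n, c i * ∏ j ∈ Finset.range i, a j) = S
  constructor
  · intro h
    have hS : S ≠ 0 := by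
      rintro rfl
      simp at h
    refine ⟨hS, ?_⟩
    rw [← mul_left_inj' hS, neg_mul, inv_mul_cancel₀ hS]
    linarith
  · rintro ⟨hS, rfl⟩
    rw [neg_mul, inv_mul_cancel₀ hS]
    norm_num
end

section
/- Fix k ≥ 1 and k-periodic real sequences (a_n), (b_n), (c_n), (d_n) with c_n ≠ 0 and a_n d_n − b_n c_n ≠ 0 for all n. For a real number x, a solution (x_n)_{n≥0} of the Riccati recurrence with x_0 = x exists if and only if both of the following hold: (i) there exist reals x_0 = x, x_1, …, x_{k−1} with c_i x_i + d_i ≠ 0 and x_{i+1} = (a_i x_i + b_i)/(c_i x_i + d_i) for 0 ≤ i ≤ k−2; and (ii) for each 0 ≤ i ≤ k−1 and every integer p ≥ 1, the (2,1) and (2,2) entries of the matrix power B_i^p satisfy (B_i^p)₂₁ · x_i + (B_i^p)₂₂ ≠ 0. -/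
/-- The matrix `!![a n, b n; c n, d n]` of coefficients. -/
def matA (a b c d : ℕ → ℝ) (n : ℕ) : Matrix (Fin 2) (Fin 2) ℝ := !![a n, b n; c n, d n]

/-- `seg A i n = A (i+n-1) * ⋯ * A (i+1) * A i`, with `seg A i 0 = 1`. -/
def seg (A : ℕ → Matrix (Fin 2) (Fin 2) ℝ) (i : ℕ) : ℕ → Matrix (Fin 2) (Fin 2) ℝ
  | 0 => 1
  | n + 1 => A (i + n) * seg A i n

/-- `B_i = A_{i-1} ⋯ A_0 ⋅ A_{k-1} ⋯ A_i`. -/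
def matB (a b c d : ℕ → ℝ) (k i : ℕ) : Matrix (Fin 2) (Fin 2) ℝ :=
  seg (matA a b c d) 0 i * seg (matA a b c d) i (k - i)

/-- `(x_n)` is a solution of the Riccati recurrence `x_{n+1} = (a_n x_n + b_n)/(c_n x_n + d_n)`. -/
def IsRiccatiSol (a b c d : ℕ → ℝ) (x : ℕ → ℝ) : Prop :=
  ∀ n, c n * x n + d n ≠ 0 ∧ x (n + 1) = (a n * x n + b n) / (c n * x n + d n)

theorem seg_add (A : ℕ → Matrix (Fin 2) (Fin 2) ℝ) (i m n : ℕ) :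
    seg A i (m + n) = seg A (i + m) n * seg A i m := by
  induction n with
  | zero => simp [seg]
  | succ n ih =>
    rw [← add_assoc]
    simp only [seg]
    rw [ih, ← mul_assoc, add_assoc]

theorem seg_per (A : ℕ → Matrix (Fin 2) (Fin 2) ℝ) (k : ℕ) (h : ∀ n, A (n + k) = A n)
    (i p n : ℕ) : seg A (i + p * k) n = seg A i n := by
  have hp : ∀ m, A (m + p * k) = A m := by
    intro m
    induction p with
    | zero => simp
    | succ p ih => rw [Nat.succ_mul, ← add_assoc, h, ih]
  induction n with
  | zero => rfl
  | succ n ih =>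
    simp only [seg]
    rw [ih, show i + p * k + n = (i + n) + p * k by ring, hp]

theorem matB_pow (a b c d : ℕ → ℝ) (k : ℕ) (h : ∀ n, matA a b c d (n + k) = matA a b c d n)
    (i : ℕ) (hi : i ≤ k) (p : ℕ) :
    matB a b c d k i ^ p = seg (matA a b c d) i (p * k) := by
  have hB : matB a b c d k i = seg (matA a b c d) i k := by
    have h1 := seg_add (matA a b c d) i (k - i) i
    have h2 := seg_per (matA a b c d) k h 0 1 i
    rw [show k - i + i = k by omega, show i + (k - i) = 0 + 1 * k by omega, h2] at h1
    rw [h1, matB]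
  induction p with
  | zero => simp [seg]
  | succ p ih => rw [pow_succ', ih, Nat.succ_mul, seg_add, seg_per _ k h, hB]

theorem seg_act (a b c d y : ℕ → ℝ) (i n : ℕ)
    (h : ∀ j < n, c (i + j) * y (i + j) + d (i + j) ≠ 0 ∧
      y (i + j + 1) = (a (i + j) * y (i + j) + b (i + j)) / (c (i + j) * y (i + j) + d (i + j))) :
    ∃ r : ℝ, r ≠ 0 ∧
      seg (matA a b c d) i n 0 0 * y i + seg (matA a b c d) i n 0 1 = r * y (i + n) ∧
      seg (matA a b c d) i n 1 0 * y i + seg (matA a b c d) i n 1 1 = r := by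
  induction n with
  | zero => exact ⟨1, by simp [seg]⟩
  | succ n ih =>
    obtain ⟨r, hr, h0, h1⟩ := ih (fun j hj => h j (by omega))
    obtain ⟨hne, hy⟩ := h n (by omega)
    refine ⟨r * (c (i + n) * y (i + n) + d (i + n)), mul_ne_zero hr hne, ?_, ?_⟩
    · rw [← add_assoc, hy, mul_assoc, mul_div_cancel₀ _ hne]
      simp only [seg, matA, Matrix.mul_apply, Fin.sum_univ_two, Matrix.of_apply,
        Matrix.cons_val_zero, Matrix.cons_val_one, Matrix.cons_val', Matrix.cons_val_fin_one] at *
      linear_combination a (i + n) * h0 + b (i + n) * h1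
    · simp only [seg, matA, Matrix.mul_apply, Fin.sum_univ_two, Matrix.of_apply,
        Matrix.cons_val_zero, Matrix.cons_val_one, Matrix.cons_val', Matrix.cons_val_fin_one] at *
      linear_combination c (i + n) * h0 + d (i + n) * h1

/-- description of the forbidden set in the k-periodic case (Theorem 3.1). -/
theorem stmt5 (k : ℕ) (hk : 1 ≤ k) (a b c d : ℕ → ℝ)
    (hper : ∀ n, a (n + k) = a n ∧ b (n + k) = b n ∧ c (n + k) = c n ∧ d (n + k) = d n)
    (hc : ∀ n, c n ≠ 0) (hdet : ∀ n, a n * d n - b n * c n ≠ 0) (x : ℝ) :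
    (∃ xs : ℕ → ℝ, IsRiccatiSol a b c d xs ∧ xs 0 = x) ↔
    ∃ y : ℕ → ℝ, y 0 = x ∧
      (∀ i, i + 2 ≤ k → c i * y i + d i ≠ 0 ∧
        y (i + 1) = (a i * y i + b i) / (c i * y i + d i)) ∧
      (∀ i < k, ∀ p ≥ 1,
        (matB a b c d k i ^ p) 1 0 * y i + (matB a b c d k i ^ p) 1 1 ≠ 0) := by
  have hA : ∀ n, matA a b c d (n + k) = matA a b c d n := by
    intro n
    obtain ⟨h1, h2, h3, h4⟩ := hper n
    simp only [matA, h1, h2, h3, h4]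
  constructor
  · rintro ⟨xs, hs, h0⟩
    refine ⟨xs, h0, fun i _ => hs i, fun i hi p _ => ?_⟩
    rw [matB_pow a b c d k hA i hi.le p]
    obtain ⟨r, hr, -, h1⟩ := seg_act a b c d xs i (p * k) (fun j _ => hs (i + j))
    rw [h1]; exact hr
  · rintro ⟨y, rfl, hy, hB⟩
    set S := seg (matA a b c d) 0 with hS
    have key : ∀ n, S n 1 0 * y 0 + S n 1 1 ≠ 0 := by
      intro n
      have hi : n % k < k := Nat.mod_lt _ (by omega)
      obtain ⟨r, hr, h0, h1⟩ := seg_act a b c d y 0 (n % k)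
        (fun j hj => by rw [zero_add]; exact hy j (by omega))
      have hn : n = n % k + n / k * k := by rw [mul_comm]; exact (Nat.mod_add_div n k).symm
      rcases Nat.eq_zero_or_pos (n / k) with hq | hq
      · rw [hq, zero_mul, add_zero] at hn
        rw [hn, hS, h1]; exact hr
      · have hb := hB (n % k) hi (n / k) hq
        rw [matB_pow a b c d k hA _ hi.le] at hb
        have hseg := seg_add (matA a b c d) 0 (n % k) (n / k * k)
        rw [← hn, zero_add] at hseg
        rw [zero_add] at h0
        rw [hS, hseg]
        have := mul_ne_zero hr hb
        intro hz
        apply this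
        rw [← hz]
        simp only [Matrix.mul_apply, Fin.sum_univ_two]
        linear_combination (-seg (matA a b c d) (n % k) (n / k * k) 1 0) * h0 -
          seg (matA a b c d) (n % k) (n / k * k) 1 1 * h1
    have hs0 : ∀ n, S (n + 1) 0 0 * y 0 + S (n + 1) 0 1 =
        a n * (S n 0 0 * y 0 + S n 0 1) + b n * (S n 1 0 * y 0 + S n 1 1) := by
      intro n
      simp [hS, seg, matA, Matrix.mul_apply, Fin.sum_univ_two]
      ring
    have hs1 : ∀ n, S (n + 1) 1 0 * y 0 + S (n + 1) 1 1 =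
        c n * (S n 0 0 * y 0 + S n 0 1) + d n * (S n 1 0 * y 0 + S n 1 1) := by
      intro n
      simp [hS, seg, matA, Matrix.mul_apply, Fin.sum_univ_two]
      ring
    refine ⟨fun n => (S n 0 0 * y 0 + S n 0 1) / (S n 1 0 * y 0 + S n 1 1), fun n => ?_, ?_⟩
    · have k0 := key n
      have k1 := key (n + 1)
      have e0 := hs0 n
      have e1 := hs1 n
      simp only
      generalize S (n + 1) 0 0 * y 0 + S (n + 1) 0 1 = u' at *
      generalize S (n + 1) 1 0 * y 0 + S (n + 1) 1 1 = v' at *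
      generalize S n 0 0 * y 0 + S n 0 1 = u at *
      generalize S n 1 0 * y 0 + S n 1 1 = v at *
      have f1 : c n * (u / v) + d n = v' / v := by rw [e1]; field_simp
      have f0 : a n * (u / v) + b n = u' / v := by rw [e0]; field_simp
      rw [f0, f1]
      exact ⟨div_ne_zero k1 k0, by field_simp⟩
    · simp [hS, seg]
end

section
/- Fix k ≥ 1 and k-periodic real sequences (a_n), (b_n), (c_n), (d_n) with c_n ≠ 0 and a_n d_n − b_n c_n ≠ 0 for all n. If the trace of B_0 = A_{k−1}···A_0 is zero, then every solution (x_n)_{n≥0} of the Riccati recurrence satisfies x_{n+2k} = x_n for all n ≥ 0. -/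
theorem seg_sol (a b c d xs : ℕ → ℝ) (h : IsRiccatiSol a b c d xs) (i n : ℕ) :
    ∃ l : ℝ, l ≠ 0 ∧
      seg (matA a b c d) i n 0 0 * xs i + seg (matA a b c d) i n 0 1 = l * xs (i + n) ∧
      seg (matA a b c d) i n 1 0 * xs i + seg (matA a b c d) i n 1 1 = l := by
  induction n with
  | zero => exact ⟨1, one_ne_zero, by simp [seg], by simp [seg]⟩
  | succ n ih =>
    obtain ⟨l, hl, h1, h2⟩ := ih
    obtain ⟨hne, hx⟩ := h (i + n)
    have hx' : xs (i + n + 1) * (c (i + n) * xs (i + n) + d (i + n))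
        = a (i + n) * xs (i + n) + b (i + n) := by
      rw [hx, div_mul_cancel₀ _ hne]
    refine ⟨l * (c (i + n) * xs (i + n) + d (i + n)), mul_ne_zero hl hne, ?_, ?_⟩
    · rw [← add_assoc]
      simp only [seg, Matrix.mul_apply, Fin.sum_univ_two]
      simp only [show matA a b c d (i + n) 0 0 = a (i + n) from rfl,
        show matA a b c d (i + n) 0 1 = b (i + n) from rfl]
      linear_combination a (i + n) * h1 + b (i + n) * h2 - l * hx'
    · simp only [seg, Matrix.mul_apply, Fin.sum_univ_two]
      simp only [show matA a b c d (i + n) 1 0 = c (i + n) from rfl,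
        show matA a b c d (i + n) 1 1 = d (i + n) from rfl]
      linear_combination c (i + n) * h1 + d (i + n) * h2

theorem seg_shift (A : ℕ → Matrix (Fin 2) (Fin 2) ℝ) (k : ℕ) (h : ∀ n, A (n + k) = A n) (n : ℕ) :
    seg A k n = seg A 0 n := by
  induction n with
  | zero => rfl
  | succ n ih => simp only [seg, ih]; rw [add_comm k n, h, zero_add]

/-- if `trace B₀ = 0` then every solution is `2k`-periodic. -/
theorem stmt6 (k : ℕ) (hk : 1 ≤ k) (a b c d : ℕ → ℝ)
    (hper : ∀ n, a (n + k) = a n ∧ b (n + k) = b n ∧ c (n + k) = c n ∧ d (n + k) = d n)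
    (hc : ∀ n, c n ≠ 0) (hdet : ∀ n, a n * d n - b n * c n ≠ 0)
    (htr : (matB a b c d k 0).trace = 0) :
    ∀ xs : ℕ → ℝ, IsRiccatiSol a b c d xs → ∀ n, xs (n + 2 * k) = xs n := by
  intro xs h n
  induction n with
  | zero =>
    have hA : ∀ n, matA a b c d (n + k) = matA a b c d n := by
      intro n
      obtain ⟨h1, h2, h3, h4⟩ := hper n
      simp only [matA, h1, h2, h3, h4]
    obtain ⟨l, hl, h1, h2⟩ := seg_sol a b c d xs h 0 k
    obtain ⟨m, hm, h3, h4⟩ := seg_sol a b c d xs h k k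
    rw [seg_shift _ k hA] at h3 h4
    simp only [matB, seg, one_mul, Nat.sub_zero, Matrix.trace_fin_two] at htr
    rw [zero_add] at h1 ⊢
    rw [two_mul]
    generalize seg (matA a b c d) 0 k = M at *
    have hs : M 1 1 = - M 0 0 := by linarith
    rw [hs] at h2 h4
    have e1 : l * m = M 0 0 ^ 2 + M 0 1 * M 1 0 := by
      linear_combination -l * h4 - M 1 0 * h1 + M 0 0 * h2
    have e2 : l * m * xs (k + k) = (M 0 0 ^ 2 + M 0 1 * M 1 0) * xs 0 := by
      linear_combination -l * h3 - M 0 0 * h1 - M 0 1 * h2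
    rw [← e1] at e2
    exact mul_left_cancel₀ (mul_ne_zero hl hm) e2
  | succ n ih =>
    have hp : ∀ f : ℕ → ℝ, (∀ n, f (n + k) = f n) → f (n + 2 * k) = f n := by
      intro f hf
      rw [two_mul, ← add_assoc, hf, hf]
    rw [show n + 1 + 2 * k = n + 2 * k + 1 by ring, (h (n + 2 * k)).2, (h n).2, ih,
      hp a fun n => (hper n).1, hp b fun n => (hper n).2.1, hp c fun n => (hper n).2.2.1,
      hp d fun n => (hper n).2.2.2]
end

section
/- Fix k ≥ 1 and k-periodic real sequences (a_n), (b_n), (c_n), (d_n) with c_n ≠ 0 and a_n d_n − b_n c_n ≠ 0 for all n. Assume T ≠ 0, c̃_i ≠ 0 for all 0 ≤ i ≤ k−1, and Δ = T² − 4D < 0 (so D > 0), and let θ ∈ (0,π) be the unique angle with cos θ = T/(2√D). If θ = (p/q)π for integers p and q with gcd(p,q) = 1 and q ≥ 2, then every solution (x_n)_{n≥0} of the Riccati recurrence satisfies x_{n+kq} = x_n for all n ≥ 0. -/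
lemma seg_period (A : ℕ → Matrix (Fin 2) (Fin 2) ℝ) (k : ℕ) (h : ∀ n, A (n + k) = A n) (n : ℕ) :
    seg A 0 (n + k) = seg A 0 n * seg A 0 k := by
  induction n with
  | zero => simp [seg]
  | succ n ih =>
    rw [show n + 1 + k = (n + k) + 1 by ring]
    simp only [seg, zero_add]
    rw [ih, h, Matrix.mul_assoc]

lemma seg_period_pow (A : ℕ → Matrix (Fin 2) (Fin 2) ℝ) (k : ℕ) (h : ∀ n, A (n + k) = A n)
    (n m : ℕ) : seg A 0 (n + k * m) = seg A 0 n * (seg A 0 k) ^ m := by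
  induction m with
  | zero => simp
  | succ m ih =>
    rw [show n + k * (m + 1) = (n + k * m) + k by ring, seg_period A k h, ih, pow_succ,
      Matrix.mul_assoc]

lemma sq_two (M : Matrix (Fin 2) (Fin 2) ℝ) : M * M = M.trace • M - M.det • 1 := by
  ext i j
  fin_cases i <;> fin_cases j <;>
    simp [Matrix.mul_apply, Fin.sum_univ_two, Matrix.trace, Matrix.det_fin_two] <;> ring

lemma pow_two_formula (M : Matrix (Fin 2) (Fin 2) ℝ) (r θ : ℝ)
    (hM : M * M = (2 * r * Real.cos θ) • M - (r ^ 2) • 1) (m : ℕ) :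
    Real.sin θ • M ^ (m + 1) = (r ^ m * Real.sin ((m + 1) * θ)) • M
      - (r ^ (m + 1) * Real.sin (m * θ)) • (1 : Matrix (Fin 2) (Fin 2) ℝ) := by
  induction m with
  | zero => simp
  | succ m ih =>
    have e : Real.sin (((m + 1 : ℕ) + 1 : ℝ) * θ) + Real.sin (m * θ)
        = 2 * Real.cos θ * Real.sin ((m + 1) * θ) := by
      push_cast
      rw [show ((m : ℝ) + 1 + 1) * θ = (m + 1) * θ + θ by ring,
        show (m : ℝ) * θ = (m + 1) * θ - θ by ring, Real.sin_add, Real.sin_sub]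
      ring
    have e2 := eq_sub_of_add_eq e
    rw [pow_succ, ← Matrix.smul_mul, ih, Matrix.sub_mul, Matrix.smul_mul, Matrix.smul_mul, hM, e2]
    push_cast
    ext i j
    simp only [Matrix.sub_apply, Matrix.smul_apply, smul_eq_mul, Matrix.one_mul]
    ring

lemma sol_vec (a b c d xs : ℕ → ℝ) (h : IsRiccatiSol a b c d xs) (n : ℕ) :
    ∃ R : ℝ, R ≠ 0 ∧ (seg (matA a b c d) 0 n).mulVec ![xs 0, 1] = R • ![xs n, 1] := by
  induction n with
  | zero => exact ⟨1, one_ne_zero, by simp [seg]⟩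
  | succ n ih =>
    obtain ⟨R, hR, e⟩ := ih
    obtain ⟨h1, h2⟩ := h n
    refine ⟨R * (c n * xs n + d n), mul_ne_zero hR h1, ?_⟩
    simp only [seg, zero_add]
    rw [← Matrix.mulVec_mulVec, e, Matrix.mulVec_smul, h2, mul_smul]
    congr 1
    ext i
    fin_cases i
    · simp [matA]
      rw [mul_div_cancel₀ _ h1]
      ring
    · simp [matA]
      ring

/-- `Δ < 0` and `θ = (p/q)π` rational multiple of `π`: every solution is
`kq`-periodic. -/
theorem stmt9 (k : ℕ) (hk : 1 ≤ k) (a b c d : ℕ → ℝ)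
    (hper : ∀ n, a (n + k) = a n ∧ b (n + k) = b n ∧ c (n + k) = c n ∧ d (n + k) = d n)
    (hc : ∀ n, c n ≠ 0) (hdet : ∀ n, a n * d n - b n * c n ≠ 0)
    (hT : (matB a b c d k 0).trace ≠ 0)
    (hctil : ∀ i < k, (matB a b c d k i) 1 0 ≠ 0)
    (hΔ : (matB a b c d k 0).trace ^ 2 - 4 * (matB a b c d k 0).det < 0)
    (θ : ℝ) (hθ : θ ∈ Set.Ioo 0 Real.pi)
    (hcos : Real.cos θ = (matB a b c d k 0).trace / (2 * Real.sqrt (matB a b c d k 0).det))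
    (p : ℤ) (q : ℕ) (hq : 2 ≤ q) (hgcd : Int.gcd p (q : ℤ) = 1)
    (hθeq : θ = ((p : ℝ) / (q : ℝ)) * Real.pi) :
    ∀ xs : ℕ → ℝ, IsRiccatiSol a b c d xs → ∀ n, xs (n + k * q) = xs n := by
  intro xs hs n
  have hB : matB a b c d k 0 = seg (matA a b c d) 0 k := by simp [matB, seg]
  rw [hB] at hΔ hcos
  have hA : ∀ n, matA a b c d (n + k) = matA a b c d n := by
    intro n
    obtain ⟨h1, h2, h3, h4⟩ := hper n
    simp [matA, h1, h2, h3, h4]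
  have key := seg_period_pow (matA a b c d) k hA n q
  set M := seg (matA a b c d) 0 k with hMdef
  have hD : 0 < M.det := by nlinarith [sq_nonneg M.trace]
  have hr : 0 < Real.sqrt M.det := Real.sqrt_pos.mpr hD
  have hM : M * M = (2 * Real.sqrt M.det * Real.cos θ) • M - (Real.sqrt M.det ^ 2) • 1 := by
    rw [Real.sq_sqrt hD.le, hcos, mul_div_cancel₀ _ (by positivity)]
    exact sq_two M
  obtain ⟨m, rfl⟩ : ∃ m, q = m + 1 := ⟨q - 1, by omega⟩
  have hf := pow_two_formula M _ θ hM m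
  have hsq : Real.sin ((m + 1) * θ) = 0 := by
    rw [hθeq]
    push_cast
    rw [show ((m : ℝ) + 1) * ((p : ℝ) / ((m : ℝ) + 1) * Real.pi) = p * Real.pi by field_simp]
    exact Real.sin_int_mul_pi p
  have hsin : Real.sin θ ≠ 0 := (Real.sin_pos_of_mem_Ioo hθ).ne'
  obtain ⟨s, hs'⟩ : ∃ s : ℝ, M ^ (m + 1) = s • (1 : Matrix (Fin 2) (Fin 2) ℝ) := by
    refine ⟨(Real.sin θ)⁻¹ * -(Real.sqrt M.det ^ (m + 1) * Real.sin (m * θ)), ?_⟩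
    rw [hsq, mul_zero, zero_smul, zero_sub, ← neg_smul] at hf
    rw [mul_smul, ← hf, smul_smul, inv_mul_cancel₀ hsin, one_smul]
  obtain ⟨R, hR, e⟩ := sol_vec a b c d xs hs n
  obtain ⟨R', hR', e'⟩ := sol_vec a b c d xs hs (n + k * (m + 1))
  rw [key, hs', Matrix.mul_smul, Matrix.mul_one, Matrix.smul_mulVec, e] at e'
  have e0 := congrFun e' 0
  have e1 := congrFun e' 1
  simp at e0 e1
  apply mul_left_cancel₀ hR'
  rw [← e0, ← e1]
  ring
end

section
/- Fix k ≥ 1 and k-periodic real sequences (a_n), (b_n), (c_n), (d_n) with c_n ≠ 0 and a_n d_n − b_n c_n ≠ 0 for all n. Assume T ≠ 0, c̃_i ≠ 0 for all 0 ≤ i ≤ k−1, and Δ = T² − 4D < 0 (so D > 0), and let θ ∈ (0,π) be the unique angle with cos θ = T/(2√D). If θ/π is irrational, then for every solution (x_n)_{n≥0} of the Riccati recurrence, the set {x_n : n ≥ 0} is dense in ℝ. -/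
open Real in
lemma aux_phi (u S : ℝ) (hS : 0 < S) : ∃ φ : ℝ, sin φ ≠ 0 ∧ sin φ * u = S * cos φ := by
  refine ⟨π / 2 - arctan (u / S), ?_, ?_⟩
  · rw [sin_pi_div_two_sub]; exact (cos_arctan_pos _).ne'
  · rw [sin_pi_div_two_sub, cos_pi_div_two_sub]
    have h := tan_mul_cos (cos_arctan_pos (u / S)).ne'
    rw [tan_arctan] at h
    rw [← h]; field_simp

open Real in
lemma aux_step (p q r s C S R θ φ y y' : ℝ) (hC : C = R * cos θ) (hS : S = R * sin θ)
    (hR : 0 < R) (hT : 2 * C = p + s) (hD : C ^ 2 + S ^ 2 = p * s - q * r)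
    (hg : r * y + s ≠ 0) (hy : (r * y + s) * y' = p * y + q)
    (h0 : sin φ ≠ 0) (h1 : sin φ * (r * y + C - p) = S * cos φ) :
    sin (φ + θ) ≠ 0 ∧ sin (φ + θ) * (r * y' + C - p) = S * cos (φ + θ) := by
  have e1 : R * sin (φ + θ) = sin φ * (r * y + s) := by
    rw [sin_add]
    have : s = 2 * C - p := by linarith
    rw [this]
    linear_combination (-1 : ℝ) * h1 - sin φ * hC - cos φ * hS
  have e2 : R * cos (φ + θ) = cos φ * C - sin φ * S := by
    rw [cos_add, hC, hS]; ring
  have e3 : (r * y + s) * (r * y' + C - p) = C * (r * y + C - p) - S ^ 2 := by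
    linear_combination r * hy + hD - C * hT
  refine ⟨?_, ?_⟩
  · intro h; rw [h, mul_zero] at e1; exact mul_ne_zero h0 hg e1.symm
  · apply mul_left_cancel₀ hR.ne'
    linear_combination (r * y' + C - p) * e1 + sin φ * e3 + C * h1 - S * e2

open Real in
lemma aux_dense (r e S θ φ : ℝ) (y : ℕ → ℝ) (hr : r ≠ 0) (hS : 0 < S)
    (hirr : Irrational (θ / π))
    (h : ∀ n : ℕ, sin (φ + n * θ) ≠ 0 ∧ sin (φ + n * θ) * (r * y n + e) = S * cos (φ + n * θ)) :
    Dense (Set.range y) := by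
  have : Fact (0 < π) := ⟨pi_pos⟩
  have hd : DenseRange (fun n : ℕ => n • (θ : AddCircle π)) :=
    denseRange_zsmul_iff_nsmul.1 (AddCircle.denseRange_zsmul_coe_iff.2 hirr)
  rw [dense_iff_inter_open]
  rintro U hU ⟨t, ht⟩
  let F : ℝ → ℝ := fun ψ => (S * cos (φ + ψ) / sin (φ + ψ) - e) / r
  have hN : IsOpen {ψ : ℝ | sin (φ + ψ) ≠ 0} :=
    isOpen_ne_fun (by fun_prop) continuous_const
  have hF : ContinuousOn F {ψ : ℝ | sin (φ + ψ) ≠ 0} := by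
    apply ContinuousOn.div_const
    apply ContinuousOn.sub _ continuousOn_const
    apply ContinuousOn.div (by fun_prop) (by fun_prop)
    intro x hx; exact hx
  have hV : IsOpen ({ψ : ℝ | sin (φ + ψ) ≠ 0} ∩ F ⁻¹' U) := hF.isOpen_inter_preimage hN hU
  obtain ⟨α, ha, hb⟩ := aux_phi (r * t + e) S hS
  have hne : ({ψ : ℝ | sin (φ + ψ) ≠ 0} ∩ F ⁻¹' U).Nonempty := by
    refine ⟨α - φ, ?_, ?_⟩
    · simpa using ha
    · have : F (α - φ) = t := by
        simp only [F, add_sub_cancel]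
        rw [← hb]; field_simp; ring
      simpa [this] using ht
  have hO : IsOpen ((fun x : ℝ => (x : AddCircle π)) '' ({ψ : ℝ | sin (φ + ψ) ≠ 0} ∩ F ⁻¹' U)) :=
    QuotientAddGroup.isOpenMap_coe _ hV
  obtain ⟨n, ψ, ⟨h1, h2⟩, h3⟩ := hd.exists_mem_open hO (hne.image _)
  have h3' : ((ψ : ℝ) : AddCircle π) = ((n * θ : ℝ) : AddCircle π) := by
    simpa [← nsmul_eq_mul] using h3
  rw [← sub_eq_zero, ← AddCircle.coe_sub, AddCircle.coe_eq_zero_iff] at h3'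
  obtain ⟨m, hm⟩ := h3'
  have hm2 : φ + ψ = φ + n * θ + m * π := by
    rw [zsmul_eq_mul] at hm; linarith
  refine ⟨y n, ?_, n, rfl⟩
  obtain ⟨g0, g1⟩ := h n
  have key : F ψ = y n := by
    have hz : ((-1 : ℝ)) ^ m ≠ 0 := zpow_ne_zero _ (by norm_num)
    simp only [F]
    rw [hm2, sin_add_int_mul_pi, cos_add_int_mul_pi]
    rw [div_eq_iff hr, sub_eq_iff_eq_add, div_eq_iff (mul_ne_zero hz g0)]
    linear_combination (-(-1 : ℝ) ^ m) * g1
  rw [← key]; exact h2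

lemma aux_per (k : ℕ) (a : ℕ → ℝ) (h : ∀ n, a (n + k) = a n) (m n : ℕ) :
    a (m * k + n) = a n := by
  induction m with
  | zero => simp
  | succ m ih => rw [show (m + 1) * k + n = m * k + n + k by ring, h, ih]

lemma aux_orbit (k : ℕ) (a b c d : ℕ → ℝ)
    (hper : ∀ n, a (n + k) = a n ∧ b (n + k) = b n ∧ c (n + k) = c n ∧ d (n + k) = d n)
    (xs : ℕ → ℝ) (hx : IsRiccatiSol a b c d xs) (m n : ℕ) :
    (seg (matA a b c d) 0 n) 1 0 * xs (m * k) + (seg (matA a b c d) 0 n) 1 1 ≠ 0 ∧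
    ((seg (matA a b c d) 0 n) 1 0 * xs (m * k) + (seg (matA a b c d) 0 n) 1 1) * xs (m * k + n) =
    (seg (matA a b c d) 0 n) 0 0 * xs (m * k) + (seg (matA a b c d) 0 n) 0 1 := by
  induction n with
  | zero => simp [seg]
  | succ n ih =>
    obtain ⟨i1, i2⟩ := ih
    obtain ⟨x1, x2⟩ := hx (m * k + n)
    have pa := aux_per k a (fun n => (hper n).1) m n
    have pb := aux_per k b (fun n => (hper n).2.1) m n
    have pc := aux_per k c (fun n => (hper n).2.2.1) m n
    have pd := aux_per k d (fun n => (hper n).2.2.2) m n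
    rw [pa, pb, pc, pd] at x2
    rw [pc, pd] at x1
    rw [eq_div_iff x1] at x2
    simp only [seg]
    generalize seg (matA a b c d) 0 n = M at *
    simp only [matA, Matrix.mul_apply, Fin.sum_univ_two, zero_add, Matrix.of_apply,
      Matrix.cons_val_zero, Matrix.cons_val_one, Matrix.cons_val', Matrix.cons_val_fin_one]
    rw [← add_assoc (m * k) n 1]
    have e : (c n * M 0 0 + d n * M 1 0) * xs (m * k) + (c n * M 0 1 + d n * M 1 1) =
        (M 1 0 * xs (m * k) + M 1 1) * (c n * xs (m * k + n) + d n) := by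
      linear_combination -c n * i2
    rw [e]
    refine ⟨mul_ne_zero i1 x1, ?_⟩
    linear_combination (M 1 0 * xs (m * k) + M 1 1) * x2 + a n * i2

/-- `Δ < 0` and `θ/π` irrational: every solution is dense in `ℝ`. -/
theorem stmt10 (k : ℕ) (hk : 1 ≤ k) (a b c d : ℕ → ℝ)
    (hper : ∀ n, a (n + k) = a n ∧ b (n + k) = b n ∧ c (n + k) = c n ∧ d (n + k) = d n)
    (hc : ∀ n, c n ≠ 0) (hdet : ∀ n, a n * d n - b n * c n ≠ 0)
    (hT : (matB a b c d k 0).trace ≠ 0)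
    (hctil : ∀ i < k, (matB a b c d k i) 1 0 ≠ 0)
    (hΔ : (matB a b c d k 0).trace ^ 2 - 4 * (matB a b c d k 0).det < 0)
    (θ : ℝ) (hθ : θ ∈ Set.Ioo 0 Real.pi)
    (hcos : Real.cos θ = (matB a b c d k 0).trace / (2 * Real.sqrt (matB a b c d k 0).det))
    (hirr : Irrational (θ / Real.pi)) :
    ∀ xs : ℕ → ℝ, IsRiccatiSol a b c d xs → Dense (Set.range xs) := by
  intro xs hx
  have hB : matB a b c d k 0 = seg (matA a b c d) 0 k := by simp [matB, seg]
  have hr := hctil 0 (by omega)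
  rw [hB] at hr hΔ hcos
  have ho := fun m => aux_orbit k a b c d hper xs hx m k
  rw [Matrix.trace_fin_two, Matrix.det_fin_two] at hΔ hcos
  generalize seg (matA a b c d) 0 k = M at *
  set D := M 0 0 * M 1 1 - M 0 1 * M 1 0 with hD
  have hDpos : 0 < D := by nlinarith [sq_nonneg (M 0 0 + M 1 1)]
  have hR : 0 < Real.sqrt D := Real.sqrt_pos.2 hDpos
  have hR2 : Real.sqrt D ^ 2 = D := Real.sq_sqrt hDpos.le
  have hsin := Real.sin_pos_of_mem_Ioo hθ
  obtain ⟨C, hC⟩ : ∃ C, C = Real.sqrt D * Real.cos θ := ⟨_, rfl⟩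
  obtain ⟨S, hS⟩ : ∃ S, S = Real.sqrt D * Real.sin θ := ⟨_, rfl⟩
  have hSpos : 0 < S := by rw [hS]; positivity
  have hC2 : 2 * C = M 0 0 + M 1 1 := by rw [hC, hcos]; field_simp
  have hCS : C ^ 2 + S ^ 2 = M 0 0 * M 1 1 - M 0 1 * M 1 0 := by
    rw [hC, hS, ← hD]
    linear_combination hR2 + Real.sqrt D ^ 2 * Real.sin_sq_add_cos_sq θ
  obtain ⟨φ, p0, p1⟩ := aux_phi (M 1 0 * xs 0 + C - M 0 0) S hSpos
  have main : Dense (Set.range fun n : ℕ => xs (n * k)) := by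
    refine aux_dense (M 1 0) (C - M 0 0) S θ φ _ hr hSpos hirr ?_
    intro n
    induction n with
    | zero => simpa [add_sub_assoc] using And.intro p0 p1
    | succ n ih =>
      obtain ⟨o1, o2⟩ := ho n
      have := aux_step (M 0 0) (M 0 1) (M 1 0) (M 1 1) C S (Real.sqrt D) θ (φ + n * θ)
        (xs (n * k)) (xs (n * k + k)) hC hS hR hC2 hCS o1 o2 ih.1
        (by rw [← ih.2]; ring)
      rw [show φ + ((n + 1 : ℕ) : ℝ) * θ = φ + n * θ + θ by push_cast; ring,
        show (n + 1) * k = n * k + k by ring, ← add_sub_assoc]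
      exact this
  refine main.mono ?_
  rintro _ ⟨n, rfl⟩
  exact ⟨_, rfl⟩
end

section
/- Fix an integer k ≥ 1 and k-periodic real sequences (a_n), (c_n) with a_n c_n ≠ 0 for all n. Define S_i = Σ_{j=0}^{i−1} c_j ∏_{r=0}^{j−1} a_r, P_i = ∏_{j=0}^{i−1} a_j, and let E_n = (ã^n − 1)/(ã − 1) if ã ≠ 1 and E_n = n if ã = 1. Then for a real number x, a solution (x_n)_{n≥0} of x_{n+1} = a_n x_n/(c_n x_n + 1) with x_0 = x exists if and only if both: (i) for all 0 ≤ i ≤ k−2, x·(S_i + c_i P_i) + 1 ≠ 0; and (ii) for all 0 ≤ i ≤ k−1 and all integers n ≥ 1, x·(S_i + E_n·c̃_i·P_i) + 1 ≠ 0. -/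
/-- `ã = ∏_{j=0}^{k-1} a_j`. -/
def atil (a : ℕ → ℝ) (k : ℕ) : ℝ := ∏ j ∈ Finset.range k, a j

/-- `S_i = Σ_{j=0}^{i-1} c_j ∏_{r=0}^{j-1} a_r`. -/
def Ssum (a c : ℕ → ℝ) (i : ℕ) : ℝ :=
  ∑ j ∈ Finset.range i, c j * ∏ r ∈ Finset.range j, a r

/-- `P_i = ∏_{j=0}^{i-1} a_j`. -/
def Pprod (a : ℕ → ℝ) (i : ℕ) : ℝ := ∏ j ∈ Finset.range i, a j

/-- `c̃_i = (∏_{j=i}^{k-1} a_j)·(Σ_{l=0}^{i-1} c_l ∏_{r=0}^{l-1} a_r)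
    + Σ_{s=i}^{k-1} c_s ∏_{t=i}^{s-1} a_t`. -/
def ctil (a c : ℕ → ℝ) (k i : ℕ) : ℝ :=
  (∏ j ∈ Finset.Ico i k, a j) * (∑ l ∈ Finset.range i, c l * ∏ r ∈ Finset.range l, a r)
    + ∑ s ∈ Finset.Ico i k, c s * ∏ t ∈ Finset.Ico i s, a t

/-- `E_n = (ã^n - 1)/(ã - 1)` if `ã ≠ 1`, and `E_n = n` if `ã = 1`. -/
noncomputable def En (atilde : ℝ) (n : ℕ) : ℝ :=
  if atilde = 1 then (n : ℝ) else (atilde ^ n - 1) / (atilde - 1)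

theorem Ssum_succ' (a c : ℕ → ℝ) (m : ℕ) :
    Ssum a c (m + 1) = Ssum a c m + c m * Pprod a m := by
  simp [Ssum, Pprod, Finset.sum_range_succ]

theorem Pprod_succ' (a : ℕ → ℝ) (m : ℕ) : Pprod a (m + 1) = Pprod a m * a m := by
  simp [Pprod, Finset.prod_range_succ]

theorem Pprod_add' (k : ℕ) (a : ℕ → ℝ) (h : ∀ n, a (n + k) = a n) (m : ℕ) :
    Pprod a (m + k) = atil a k * Pprod a m := by
  induction m with
  | zero => simp [Pprod, atil]
  | succ m ih =>
    rw [show m + 1 + k = (m + k) + 1 by ring, Pprod_succ', Pprod_succ', ih, h]; ring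

theorem Ssum_add' (k : ℕ) (a c : ℕ → ℝ) (h : ∀ n, a (n + k) = a n ∧ c (n + k) = c n) (m : ℕ) :
    Ssum a c (m + k) = Ssum a c k + atil a k * Ssum a c m := by
  induction m with
  | zero => simp [Ssum]
  | succ m ih =>
    rw [show m + 1 + k = (m + k) + 1 by ring, Ssum_succ', Ssum_succ', ih,
      Pprod_add' k a (fun n => (h n).1), (h m).2]; ring

theorem En_mul' (t : ℝ) (n : ℕ) : En t n * (t - 1) = t ^ n - 1 := by
  unfold En
  split_ifs with h
  · simp [h]
  · exact div_mul_cancel₀ _ (sub_ne_zero.2 h)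

theorem En_succ' (t : ℝ) (n : ℕ) : En t (n + 1) = 1 + t * En t n := by
  unfold En
  split_ifs with h
  · simp [h]; ring
  · have := sub_ne_zero.2 h
    field_simp
    ring

theorem Ssum_mul' (k : ℕ) (a c : ℕ → ℝ) (h : ∀ n, a (n + k) = a n ∧ c (n + k) = c n) (i n : ℕ) :
    Ssum a c (i + n * k) = En (atil a k) n * Ssum a c k + atil a k ^ n * Ssum a c i := by
  induction n with
  | zero => simp [En]
  | succ n ih =>
    rw [show i + (n + 1) * k = (i + n * k) + k by ring, Ssum_add' k a c h, ih, En_succ']; ring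

theorem ctil_mul' (k : ℕ) (a c : ℕ → ℝ) (i : ℕ) (hi : i ≤ k) :
    ctil a c k i * Pprod a i = atil a k * Ssum a c i + (Ssum a c k - Ssum a c i) := by
  have h1 : ∀ s, i ≤ s → (∏ t ∈ Finset.Ico i s, a t) * Pprod a i = Pprod a s := by
    intro s hs
    rw [mul_comm]
    exact Finset.prod_range_mul_prod_Ico a hs
  have h2 : (∑ s ∈ Finset.Ico i k, c s * ∏ t ∈ Finset.Ico i s, a t) * Pprod a i
      = Ssum a c k - Ssum a c i := by
    unfold Ssum
    rw [← Finset.sum_Ico_eq_sub _ hi, Finset.sum_mul]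
    refine Finset.sum_congr rfl fun s hs => ?_
    rw [mul_assoc, h1 s (Finset.mem_Ico.1 hs).1]; rfl
  have h3 := h1 k hi
  have h4 : atil a k = Pprod a k := rfl
  rw [h4, ← h2, ← h3]
  unfold ctil Ssum
  ring

theorem key' (k : ℕ) (a c : ℕ → ℝ) (h : ∀ n, a (n + k) = a n ∧ c (n + k) = c n) (i n : ℕ)
    (hi : i ≤ k) :
    Ssum a c i + En (atil a k) n * ctil a c k i * Pprod a i = Ssum a c (i + n * k) := by
  rw [Ssum_mul' k a c h, mul_assoc, ctil_mul' k a c i hi]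
  linear_combination (Ssum a c i) * En_mul' (atil a k) n

theorem sol_iff' (a c : ℕ → ℝ) (x : ℝ) :
    (∃ xs : ℕ → ℝ, IsSol a c xs ∧ xs 0 = x) ↔ ∀ m, x * Ssum a c m + 1 ≠ 0 := by
  constructor
  · rintro ⟨xs, hs, rfl⟩
    have : ∀ m, xs 0 * Ssum a c m + 1 ≠ 0 ∧ xs m * (xs 0 * Ssum a c m + 1) = Pprod a m * xs 0 := by
      intro m
      induction m with
      | zero => simp [Ssum, Pprod]
      | succ m ih =>
        obtain ⟨h1, h2⟩ := ih
        obtain ⟨h3, h4⟩ := hs m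
        have h5 : xs 0 * Ssum a c (m + 1) + 1 = (c m * xs m + 1) * (xs 0 * Ssum a c m + 1) := by
          rw [Ssum_succ']; linear_combination -c m * h2
        rw [h5, h4, Pprod_succ']
        refine ⟨mul_ne_zero h3 h1, ?_⟩
        rw [← mul_assoc, div_mul_cancel₀ _ h3]
        linear_combination a m * h2
    exact fun m => (this m).1
  · intro h
    refine ⟨fun m => Pprod a m * x / (x * Ssum a c m + 1), fun m => ?_, by simp [Pprod, Ssum]⟩
    have h0 := h m
    have h1 := h (m + 1)
    have h5 : c m * (Pprod a m * x / (x * Ssum a c m + 1)) + 1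
        = (x * Ssum a c (m + 1) + 1) / (x * Ssum a c m + 1) := by
      rw [Ssum_succ']; field_simp; ring
    simp only [h5]
    refine ⟨div_ne_zero h1 h0, ?_⟩
    rw [Pprod_succ']
    field_simp

/-- existence criterion (forbidden set) for the k-periodic equation
`x_{n+1} = a_n x_n / (c_n x_n + 1)` (Proposition 4.2). -/
theorem stmt11 (k : ℕ) (hk : 1 ≤ k) (a c : ℕ → ℝ)
    (hper : ∀ n, a (n + k) = a n ∧ c (n + k) = c n)
    (hac : ∀ n, a n * c n ≠ 0) (x : ℝ) :
    (∃ xs : ℕ → ℝ, IsSol a c xs ∧ xs 0 = x) ↔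
    ((∀ i, i + 2 ≤ k → x * (Ssum a c i + c i * Pprod a i) + 1 ≠ 0) ∧
     (∀ i < k, ∀ n ≥ 1,
        x * (Ssum a c i + En (atil a k) n * ctil a c k i * Pprod a i) + 1 ≠ 0)) := by
  rw [sol_iff']
  constructor
  · intro h
    refine ⟨fun i _ => ?_, fun i hi n _ => ?_⟩
    · rw [← Ssum_succ']; exact h _
    · rw [key' k a c hper i n hi.le]; exact h _
  · rintro ⟨h1, h2⟩ m
    rcases Nat.lt_or_ge m k with hm | hm
    · cases m with
      | zero => simp [Ssum]
      | succ m => rw [Ssum_succ']; exact h1 m (by omega)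
    · have := h2 (m % k) (Nat.mod_lt _ hk) (m / k) (Nat.div_pos hm hk)
      rwa [key' k a c hper _ _ (Nat.mod_lt _ hk).le, Nat.mod_add_div'] at this
end

section
/- Fix an integer k ≥ 1 and k-periodic real sequences (a_n), (c_n) with a_n c_n ≠ 0 for all n. If ã = ∏_{j=0}^{k−1} a_j = −1, then every solution (x_n)_{n≥0} of x_{n+1} = a_n x_n/(c_n x_n + 1) satisfies x_{n+2k} = x_n for all n ≥ 0. -/
/-- if `ã = -1` then every solution is `2k`-periodic. -/
theorem stmt12 (k : ℕ) (hk : 1 ≤ k) (a c : ℕ → ℝ)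
    (hper : ∀ n, a (n + k) = a n ∧ c (n + k) = c n)
    (hac : ∀ n, a n * c n ≠ 0) (hatil : atil a k = -1) :
    ∀ xs : ℕ → ℝ, IsSol a c xs → ∀ n, xs (n + 2 * k) = xs n := by
  intro xs hs
  have key : ∀ n, (∑ j ∈ Finset.range n, c j * ∏ r ∈ Finset.range j, a r) * xs 0 + 1 ≠ 0 ∧
      xs n * ((∑ j ∈ Finset.range n, c j * ∏ r ∈ Finset.range j, a r) * xs 0 + 1)
        = (∏ r ∈ Finset.range n, a r) * xs 0 := by
    intro n
    induction n with
    | zero => simp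
    | succ n ih =>
      obtain ⟨h0, h1⟩ := ih
      obtain ⟨g0, g1⟩ := hs n
      rw [Finset.sum_range_succ, Finset.prod_range_succ, g1]
      generalize (∑ j ∈ Finset.range n, c j * ∏ r ∈ Finset.range j, a r) = S at *
      generalize (∏ r ∈ Finset.range n, a r) = P at *
      have e : (S + c n * P) * xs 0 + 1 = (S * xs 0 + 1) * (c n * xs n + 1) := by
        linear_combination (- c n) * h1
      rw [e]
      refine ⟨mul_ne_zero h0 g0, ?_⟩
      have : a n * xs n / (c n * xs n + 1) * ((S * xs 0 + 1) * (c n * xs n + 1))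
          = a n * xs n * (S * xs 0 + 1) := by
        rw [mul_comm (S * xs 0 + 1), ← mul_assoc, div_mul_cancel₀ _ g0]
      rw [this]
      linear_combination a n * h1
  have hP : ∏ r ∈ Finset.range k, a r = -1 := hatil
  have hPk : ∀ i, ∏ r ∈ Finset.range (k + i), a r = - ∏ r ∈ Finset.range i, a r := by
    intro i
    rw [Finset.prod_range_add, hP, neg_one_mul]
    congr 1
    refine Finset.prod_congr rfl fun j _ => ?_
    rw [add_comm k j, (hper j).1]
  have hS : ∑ j ∈ Finset.range (2 * k), c j * ∏ r ∈ Finset.range j, a r = 0 := by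
    rw [two_mul, Finset.sum_range_add, ← Finset.sum_add_distrib]
    refine Finset.sum_eq_zero fun j _ => ?_
    rw [hPk, add_comm k j, (hper j).2]
    ring
  have h2 : xs (2 * k) = xs 0 := by
    have h := (key (2 * k)).2
    rw [hS, two_mul, hPk, hP, ← two_mul] at h
    linarith
  have hp2 : ∀ n, a (n + 2 * k) = a n ∧ c (n + 2 * k) = c n := by
    intro n
    rw [two_mul, ← add_assoc, (hper _).1, (hper _).1, (hper _).2, (hper _).2]
    exact ⟨rfl, rfl⟩
  intro n
  induction n with
  | zero => simpa using h2
  | succ n ih =>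
    rw [show n + 1 + 2 * k = n + 2 * k + 1 by ring, (hs _).2, (hs n).2, ih, (hp2 n).1, (hp2 n).2]
end

section
/- Fix an integer k ≥ 1 and k-periodic real sequences (a_n), (c_n) with a_n c_n ≠ 0 for all n. Assume |ã| < 1. Then every solution (x_n)_{n≥0} of x_{n+1} = a_n x_n/(c_n x_n + 1) such that x_i ≠ (ã − 1)/c̃_i for each 0 ≤ i ≤ k−1 with c̃_i ≠ 0 satisfies lim_{n→∞} x_n = 0. -/
lemma aux_tend (k : ℕ) (hk : 1 ≤ k) (f : ℕ → ℝ) (r : ℝ) (hr : |r| < 1)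
    (h : ∀ n, f (n + k) = r * f n) : Filter.Tendsto f Filter.atTop (nhds 0) := by
  have h1 : ∀ m i, f (i + k * m) = r ^ m * f i := by
    intro m i
    induction m with
    | zero => simp
    | succ m ih =>
      rw [show i + k * (m + 1) = (i + k * m) + k by ring, h, ih]
      ring
  have h2 : ∀ n, ‖f n‖ ≤ |r| ^ (n / k) * ∑ i ∈ Finset.range k, |f i| := by
    intro n
    have := h1 (n / k) (n % k)
    rw [Nat.mod_add_div] at this
    rw [this, Real.norm_eq_abs, abs_mul, abs_pow]
    gcongr
    exact Finset.single_le_sum (f := fun i => |f i|) (fun i _ => abs_nonneg _)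
      (Finset.mem_range.2 (Nat.mod_lt _ hk))
  apply squeeze_zero_norm h2
  have h3 := (tendsto_pow_atTop_nhds_zero_of_lt_one (abs_nonneg r) hr).comp
    (Nat.tendsto_div_const_atTop (n := k) (by omega))
  simpa using h3.mul_const (∑ i ∈ Finset.range k, |f i|)

open Filter in
/-- if `|ã| < 1` then every solution avoiding the exceptional points
converges to `0`. -/
theorem stmt13 (k : ℕ) (hk : 1 ≤ k) (a c : ℕ → ℝ)
    (hper : ∀ n, a (n + k) = a n ∧ c (n + k) = c n)
    (hac : ∀ n, a n * c n ≠ 0) (hatil : |atil a k| < 1) :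
    ∀ xs : ℕ → ℝ, IsSol a c xs →
      (∀ i < k, ctil a c k i ≠ 0 → xs i ≠ (atil a k - 1) / ctil a c k i) →
      Tendsto xs atTop (nhds 0) := by
  intro xs hs hne
  have hP : ∀ n, Pprod a (n + k) = atil a k * Pprod a n := by
    intro n
    unfold Pprod atil
    rw [add_comm, Finset.prod_range_add]
    congr 1
    exact Finset.prod_congr rfl fun j _ => by rw [add_comm, (hper j).1]
  have hS : ∀ n, Ssum a c (n + k) = Ssum a c k + atil a k * Ssum a c n := by
    intro n
    unfold Ssum
    rw [add_comm, Finset.sum_range_add, Finset.mul_sum]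
    congr 1
    refine Finset.sum_congr rfl fun j _ => ?_
    have := hP j
    unfold Pprod at this
    rw [add_comm k j, (hper j).2, this]
    ring
  have h1 : 1 - atil a k ≠ 0 := by
    have := (abs_lt.1 hatil).2
    linarith
  have hPt := aux_tend k hk (Pprod a) _ hatil hP
  have hSt := aux_tend k hk (fun n => Ssum a c n - Ssum a c k / (1 - atil a k)) _ hatil (by
    intro n
    simp only [hS]
    field_simp
    ring)
  have key : ∀ n, xs n * (1 + xs 0 * Ssum a c n) = Pprod a n * xs 0 := by
    intro n
    induction n with
    | zero => simp [Ssum, Pprod]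
    | succ n ih =>
      have e1 : Ssum a c (n + 1) = Ssum a c n + c n * Pprod a n := by
        simp [Ssum, Pprod, Finset.sum_range_succ]
      have e2 : Pprod a (n + 1) = Pprod a n * a n := by
        simp [Pprod, Finset.prod_range_succ]
      have e3 : xs (n + 1) * (c n * xs n + 1) = a n * xs n := by
        rw [(hs n).2, div_mul_cancel₀ _ (hs n).1]
      rw [e1, e2]
      linear_combination (1 + xs 0 * Ssum a c n) * e3 + (a n - c n * xs (n + 1)) * ih
  have hc : ctil a c k 0 = Ssum a c k := by
    simp [ctil, Ssum, ← Finset.range_eq_Ico]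
  have hL : 1 + xs 0 * (Ssum a c k / (1 - atil a k)) ≠ 0 := by
    intro h0
    have h0' : xs 0 * Ssum a c k = atil a k - 1 := by
      field_simp at h0
      linarith
    have hSk : Ssum a c k ≠ 0 := by
      intro hz
      rw [hz] at h0'
      apply h1
      linarith
    refine hne 0 (by omega) (by rwa [hc]) ?_
    rw [hc, eq_div_iff hSk, h0']
  have hQ : Tendsto (fun n => 1 + xs 0 * Ssum a c n) atTop
      (nhds (1 + xs 0 * (Ssum a c k / (1 - atil a k)))) := by
    have := hSt.add_const (Ssum a c k / (1 - atil a k))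
    simp only [sub_add_cancel, zero_add] at this
    exact (this.const_mul _).const_add _
  have hlim := (hPt.mul_const (xs 0)).div hQ hL
  rw [zero_mul, zero_div] at hlim
  refine hlim.congr' ?_
  filter_upwards [hQ.eventually_ne hL] with n hn
  simp only [Pi.div_apply]
  rw [← key n, mul_div_cancel_right₀ _ hn]
end

section
/- Fix an integer k ≥ 1 and k-periodic real sequences (a_n), (c_n) with a_n c_n ≠ 0 for all n. Assume ã = 1 and c̃_i ≠ 0 for all 0 ≤ i ≤ k−1. Then every solution (x_n)_{n≥0} of x_{n+1} = a_n x_n/(c_n x_n + 1) satisfies lim_{n→∞} x_n = 0. -/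
theorem periodic_bdd_aux (f : ℕ → ℝ) (k : ℕ) (hk : 1 ≤ k) (hf : ∀ n, f (n + k) = f n) :
    ∃ B, ∀ n, |f n| ≤ B := by
  refine ⟨∑ i ∈ Finset.range k, |f i|, fun n => ?_⟩
  have h : Function.Periodic f k := hf
  rw [← h.map_mod_nat n]
  exact Finset.single_le_sum (f := fun i => |f i|) (fun i _ => abs_nonneg _)
    (Finset.mem_range.2 (Nat.mod_lt _ hk))

open Filter in
/-- if `ã = 1` and all `c̃_i ≠ 0` then every solution converges to `0`. -/
theorem stmt14 (k : ℕ) (hk : 1 ≤ k) (a c : ℕ → ℝ)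
    (hper : ∀ n, a (n + k) = a n ∧ c (n + k) = c n)
    (hac : ∀ n, a n * c n ≠ 0) (hatil : atil a k = 1)
    (hctil : ∀ i < k, ctil a c k i ≠ 0) :
    ∀ xs : ℕ → ℝ, IsSol a c xs → Tendsto xs atTop (nhds 0) := by
  intro xs hxs
  have hP1 : ∀ n, Pprod a (n + 1) = Pprod a n * a n := fun n => by
    simp [Pprod, Finset.prod_range_succ]
  have hS1 : ∀ n, Ssum a c (n + 1) = Ssum a c n + c n * Pprod a n := fun n => by
    simp [Ssum, Pprod, Finset.sum_range_succ]
  have hPk : Pprod a k = 1 := hatil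
  have hPper : ∀ n, Pprod a (n + k) = Pprod a n := by
    intro n
    induction n with
    | zero => rw [Nat.zero_add, hPk]; simp [Pprod]
    | succ n ih => rw [Nat.add_right_comm, hP1, hP1, ih, (hper n).1]
  have hSper : ∀ n, Ssum a c (n + k) = Ssum a c n + Ssum a c k := by
    intro n
    induction n with
    | zero => simp [Ssum]
    | succ n ih => rw [Nat.add_right_comm, hS1, hS1, ih, (hper n).2, hPper]; ring
  have hSk : Ssum a c k ≠ 0 := by
    have := hctil 0 hk
    simpa [ctil, Ssum, ← Finset.range_eq_Ico] using this
  have hP0 : ∀ n, Pprod a n ≠ 0 := fun n =>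
    Finset.prod_ne_zero_iff.2 fun j _ => left_ne_zero_of_mul (hac j)
  have hkey : ∀ n, xs n * (1 + xs 0 * Ssum a c n) = xs 0 * Pprod a n := by
    intro n
    induction n with
    | zero => simp [Ssum, Pprod]
    | succ n ih =>
      obtain ⟨h0, h1⟩ := hxs n
      have h2 : xs (n + 1) * (c n * xs n + 1) = a n * xs n := by
        rw [h1, div_mul_cancel₀ _ h0]
      rw [hS1, hP1]
      linear_combination (1 + xs 0 * Ssum a c n) * h2 + (a n - xs (n+1) * c n) * ih
  have hk0 : (k : ℝ) ≠ 0 := by positivity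
  obtain ⟨B, hB⟩ := periodic_bdd_aux (Pprod a) k hk hPper
  obtain ⟨D, hD⟩ := periodic_bdd_aux
    (fun n => 1 + xs 0 * (Ssum a c n - n * (Ssum a c k / k))) k hk (by
      intro n
      simp only [hSper, Nat.cast_add]
      field_simp
      ring)
  by_cases hx0 : xs 0 = 0
  · have : ∀ n, xs n = 0 := fun n => by simpa [hx0] using hkey n
    rw [show xs = fun _ => 0 from funext this]
    exact tendsto_const_nhds
  have hr : 0 < |xs 0 * (Ssum a c k / k)| := by
    rw [abs_pos]; exact mul_ne_zero hx0 (div_ne_zero hSk hk0)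
  have ht : Tendsto (fun n => |1 + xs 0 * Ssum a c n|) atTop atTop := by
    have h1 : Tendsto (fun n : ℕ => (n : ℝ) * |xs 0 * (Ssum a c k / k)| + -D) atTop atTop :=
      tendsto_atTop_add_const_right _ _ (tendsto_natCast_atTop_atTop.atTop_mul_const hr)
    refine tendsto_atTop_mono (fun n => ?_) h1
    have h2 := hD n
    have h3 : (n : ℝ) * |xs 0 * (Ssum a c k / k)| = |n * (xs 0 * (Ssum a c k / k))| := by
      rw [abs_mul (n : ℝ), Nat.abs_cast]
    have h4 := abs_sub (1 + xs 0 * Ssum a c n)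
      (1 + xs 0 * (Ssum a c n - n * (Ssum a c k / k)))
    rw [show 1 + xs 0 * Ssum a c n - (1 + xs 0 * (Ssum a c n - n * (Ssum a c k / k)))
      = n * (xs 0 * (Ssum a c k / k)) by ring] at h4
    rw [h3]
    linarith
  have h5 : Tendsto (fun n => |xs 0| * B * |1 + xs 0 * Ssum a c n|⁻¹) atTop (nhds 0) := by
    simpa using ht.inv_tendsto_atTop.const_mul (|xs 0| * B)
  refine squeeze_zero_norm (fun n => ?_) h5
  have hne : 1 + xs 0 * Ssum a c n ≠ 0 := by
    intro h
    have := hkey n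
    rw [h, mul_zero] at this
    exact mul_ne_zero hx0 (hP0 n) this.symm
  rw [Real.norm_eq_abs, ← div_eq_mul_inv, le_div_iff₀ (abs_pos.2 hne), ← abs_mul, hkey, abs_mul]
  exact mul_le_mul_of_nonneg_left (hB n) (abs_nonneg _)
end

section
/- Fix an integer k ≥ 1 and k-periodic real sequences (a_n), (c_n) with a_n > 0 and c_n > 0 for all n, and let x be a real number with x > 0. Then a solution (x_n)_{n≥0} of x_{n+1} = a_n x_n/(c_n x_n + 1) with x_0 = x exists and satisfies x_n > 0 for all n; moreover: (1) if ã ≤ 1 then lim_{n→∞} x_n = 0; (2) if ã > 1 then lim_{n→∞} x_{nk+i} = (ã − 1)/c̃_i for each 0 ≤ i ≤ k−1 (here c̃_i > 0). -/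
theorem ctil_pos' (k : ℕ) (a c : ℕ → ℝ) (ha : ∀ n, 0 < a n) (hc : ∀ n, 0 < c n)
    (i : ℕ) (hi : i < k) : 0 < ctil a c k i := by
  unfold ctil
  have h1 : 0 ≤ (∏ j ∈ Finset.Ico i k, a j) *
      (∑ l ∈ Finset.range i, c l * ∏ r ∈ Finset.range l, a r) :=
    mul_nonneg (Finset.prod_nonneg fun j _ => (ha j).le)
      (Finset.sum_nonneg fun l _ => mul_nonneg (hc l).le
        (Finset.prod_nonneg fun j _ => (ha j).le))
  have h2 : 0 < ∑ s ∈ Finset.Ico i k, c s * ∏ t ∈ Finset.Ico i s, a t :=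
    Finset.sum_pos (fun s _ => mul_pos (hc s) (Finset.prod_pos fun j _ => ha j))
      (Finset.nonempty_Ico.mpr hi)
  linarith

theorem step_aux (a c y : ℕ → ℝ) (hy : ∀ s, a s * y (s + 1) = y s + c s)
    (i s : ℕ) (h : i ≤ s) :
    y s * ∏ t ∈ Finset.Ico i s, a t
      = y i + ∑ j ∈ Finset.Ico i s, c j * ∏ t ∈ Finset.Ico i j, a t := by
  induction s, h using Nat.le_induction with
  | base => simp
  | succ s hs ih =>
    rw [Finset.prod_Ico_succ_top hs, Finset.sum_Ico_succ_top hs, ← add_assoc, ← ih]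
    linear_combination (∏ t ∈ Finset.Ico i s, a t) * hy s

theorem period_aux (k : ℕ) (a c y : ℕ → ℝ)
    (hper : ∀ n, a (n + k) = a n ∧ c (n + k) = c n)
    (hy : ∀ s, a s * y (s + 1) = y s + c s) (i : ℕ) (hi : i < k) (n : ℕ) :
    atil a k * y ((n + 1) * k + i) = y (n * k + i) + ctil a c k i := by
  have hp : ∀ n s, a (n * k + s) = a s ∧ c (n * k + s) = c s := by
    intro n
    induction n with
    | zero => simp
    | succ n ih =>
      intro s
      have e : (n + 1) * k + s = n * k + s + k := by ring
      rw [e, (hper _).1, (hper _).2]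
      exact ih s
  have hy' : ∀ n s, a s * y (n * k + (s + 1)) = y (n * k + s) + c s := by
    intro n s
    have := hy (n * k + s)
    rw [(hp n s).1, (hp n s).2] at this
    exact this
  have h1 := step_aux a c (fun s => y (n * k + s)) (hy' n) i k hi.le
  have h2 := step_aux a c (fun s => y ((n + 1) * k + s)) (hy' (n + 1)) 0 i (Nat.zero_le i)
  have e : (n + 1) * k + 0 = n * k + k := by ring
  simp only [e] at h1 h2
  have h3 : atil a k = (∏ t ∈ Finset.Ico 0 i, a t) * ∏ t ∈ Finset.Ico i k, a t := by
    rw [atil, Finset.range_eq_Ico, Finset.prod_Ico_consecutive _ (Nat.zero_le i) hi.le]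
  rw [h3, ctil]
  simp only [Finset.range_eq_Ico]
  linear_combination h1 + (∏ t ∈ Finset.Ico i k, a t) * h2

theorem sol_pos (a c xs : ℕ → ℝ) (ha : ∀ n, 0 < a n) (hc : ∀ n, 0 < c n)
    (h0 : 0 < xs 0) (h : ∀ n, xs (n + 1) = a n * xs n / (c n * xs n + 1)) (n : ℕ) :
    0 < xs n := by
  induction n with
  | zero => exact h0
  | succ n ih =>
    rw [h]
    have := ha n
    have := hc n
    positivity

open Filter in
theorem tendsto_of_residues (k : ℕ) (hk : 1 ≤ k) (xs : ℕ → ℝ) (l : ℝ)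
    (h : ∀ i < k, Tendsto (fun n => xs (n * k + i)) atTop (nhds l)) :
    Tendsto xs atTop (nhds l) := by
  intro U hU
  have h1 : ∀ᶠ n in atTop, ∀ i ∈ Finset.range k, xs (n * k + i) ∈ U := by
    rw [Filter.eventually_all_finset]
    intro i hi
    exact (h i (Finset.mem_range.mp hi)) hU
  have h2 := (Nat.tendsto_div_const_atTop (by omega : k ≠ 0)).eventually h1
  rw [Filter.mem_map]
  filter_upwards [h2] with n hn
  rw [Set.mem_preimage]
  have := hn (n % k) (Finset.mem_range.mpr (Nat.mod_lt _ hk))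
  rwa [Nat.div_add_mod'] at this

open Filter in
/-- positive coefficients and positive initial value: a positive solution
exists; it tends to `0` if `ã ≤ 1`, and `x_{nk+i} → (ã-1)/c̃_i` if `ã > 1`. -/
theorem stmt16 (k : ℕ) (hk : 1 ≤ k) (a c : ℕ → ℝ)
    (hper : ∀ n, a (n + k) = a n ∧ c (n + k) = c n)
    (ha : ∀ n, 0 < a n) (hc : ∀ n, 0 < c n) (x : ℝ) (hx : 0 < x) :
    (∃ xs : ℕ → ℝ, IsSol a c xs ∧ xs 0 = x ∧ ∀ n, 0 < xs n) ∧
    ∀ xs : ℕ → ℝ, IsSol a c xs → xs 0 = x →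
      ((atil a k ≤ 1 → Tendsto xs atTop (nhds 0)) ∧
       (1 < atil a k → ∀ i < k, 0 < ctil a c k i ∧
          Tendsto (fun n => xs (n * k + i)) atTop
            (nhds ((atil a k - 1) / ctil a c k i)))) := by
  refine ⟨?_, ?_⟩
  · let xs : ℕ → ℝ := fun n => Nat.rec x (fun n y => a n * y / (c n * y + 1)) n
    have hpos : ∀ n, 0 < xs n := sol_pos a c xs ha hc hx (fun n => rfl)
    refine ⟨xs, fun n => ⟨?_, rfl⟩, rfl, hpos⟩
    have := mul_pos (hc n) (hpos n)
    positivity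
  · intro xs hs h0
    have hpos : ∀ n, 0 < xs n := sol_pos a c xs ha hc (h0 ▸ hx) (fun n => (hs n).2)
    have hy : ∀ s, a s * (xs (s + 1))⁻¹ = (xs s)⁻¹ + c s := by
      intro s
      have h1 := (hpos s).ne'
      have h2 := (ha s).ne'
      have h3 := (hs s).1
      rw [(hs s).2]
      field_simp
      ring
    have key := period_aux k a c (fun n => (xs n)⁻¹) hper hy
    have hA : 0 < atil a k := Finset.prod_pos fun j _ => ha j
    refine ⟨fun hle => ?_, fun hlt i hi => ⟨ctil_pos' k a c ha hc i hi, ?_⟩⟩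
    · apply tendsto_of_residues k hk
      intro i hi
      have hC := ctil_pos' k a c ha hc i hi
      have hb : ∀ n : ℕ, (n : ℝ) * ctil a c k i ≤ (xs (n * k + i))⁻¹ := by
        intro n
        induction n with
        | zero => simpa using (hpos i).le
        | succ n ih =>
          have h1 := key i hi n
          have h2 := inv_pos.mpr (hpos ((n + 1) * k + i))
          push_cast
          nlinarith
      have ht : Tendsto (fun n : ℕ => (xs (n * k + i))⁻¹) atTop atTop :=
        tendsto_atTop_mono hb (tendsto_natCast_atTop_atTop.atTop_mul_const hC)
      have hr := ht.inv_tendsto_atTop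
      refine hr.congr fun n => ?_
      simp
    · have hC := ctil_pos' k a c ha hc i hi
      have hA1 : 0 < atil a k - 1 := by linarith
      set C := ctil a c k i
      set A := atil a k
      have hf : ∀ n : ℕ, (xs (n * k + i))⁻¹ = C / (A - 1) + (A⁻¹) ^ n * ((xs i)⁻¹ - C / (A - 1)) := by
        intro n
        induction n with
        | zero => simp
        | succ n ih =>
          have h1 := key i hi n
          simp only [ih] at h1
          apply mul_left_cancel₀ hA.ne'
          rw [h1, pow_succ]
          generalize (A⁻¹) ^ n = q
          generalize (xs i)⁻¹ = r
          have := hA1.ne'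
          field_simp
          ring
      have hq : Tendsto (fun n : ℕ => (A⁻¹) ^ n) atTop (nhds 0) :=
        tendsto_pow_atTop_nhds_zero_of_lt_one (inv_pos.mpr hA).le (inv_lt_one_of_one_lt₀ hlt)
      have ht : Tendsto (fun n : ℕ => (xs (n * k + i))⁻¹) atTop (nhds (C / (A - 1))) := by
        simp only [hf]
        simpa using (hq.mul_const ((xs i)⁻¹ - C / (A - 1))).const_add (C / (A - 1))
      simpa using ht.inv₀ (div_pos hC hA1).ne'
end

section
/- Let (c_n)_{n≥0} be a real sequence with c_n ≠ 0 for all n, converging to a real number c ≠ 0. Then: (a) every solution (x_n)_{n≥0} of x_{n+1} = x_n/(c_n x_n + 1) satisfies lim_{n→∞} x_n = 0; and (b) the equilibrium 0 is not stable: there exists ε > 0 such that for every α > 0 there is a real number u with |u| < α for which a solution (x_n) with x_0 = u exists and |x_n| ≥ ε for some n. -/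
/-- `(x_n)` is a solution of `x_{n+1} = x_n / (c_n x_n + 1)`. -/
def IsSolC (c : ℕ → ℝ) (x : ℕ → ℝ) : Prop :=
  ∀ n, c n * x n + 1 ≠ 0 ∧ x (n + 1) = x n / (c n * x n + 1)

open Filter in
theorem aux_S (c : ℕ → ℝ) (cl : ℝ) (hcl : cl ≠ 0)
    (hconv : Tendsto c atTop (nhds cl)) :
    Tendsto (fun n => |∑ i ∈ Finset.range n, c i|) atTop atTop := by
  have h1 := hconv.cesaro.abs
  have h2 := (tendsto_natCast_atTop_atTop (R := ℝ)).atTop_mul_pos (abs_pos.mpr hcl) h1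
  refine h2.congr' ?_
  filter_upwards [eventually_gt_atTop 0] with n hn
  have hn' : (0 : ℝ) < n := by exact_mod_cast hn
  rw [abs_mul, abs_of_pos (inv_pos.mpr hn'), ← mul_assoc, mul_inv_cancel₀ hn'.ne', one_mul]

open Filter in
/-- if `c_n → c ≠ 0`, then (a) every solution tends to `0`;
(b) the equilibrium `0` is not stable. -/
theorem stmt18 (c : ℕ → ℝ) (hc : ∀ n, c n ≠ 0) (cl : ℝ) (hcl : cl ≠ 0)
    (hconv : Tendsto c atTop (nhds cl)) :
    (∀ xs : ℕ → ℝ, IsSolC c xs → Tendsto xs atTop (nhds 0)) ∧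
    ∃ ε > (0 : ℝ), ∀ α > (0 : ℝ), ∃ u : ℝ, |u| < α ∧
      ∃ xs : ℕ → ℝ, IsSolC c xs ∧ xs 0 = u ∧ ∃ n, ε ≤ |xs n| := by
  have hS := aux_S c cl hcl hconv
  constructor
  · intro xs hx
    by_cases h0 : xs 0 = 0
    · have : ∀ n, xs n = 0 := by
        intro n
        induction n with
        | zero => exact h0
        | succ k ih => rw [(hx k).2, ih, zero_div]
      rw [show xs = fun _ => 0 from funext this]
      exact tendsto_const_nhds
    · have hne : ∀ n, xs n ≠ 0 := by
        intro n
        induction n with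
        | zero => exact h0
        | succ k ih => rw [(hx k).2]; exact div_ne_zero ih (hx k).1
      have hf : ∀ n, (xs n)⁻¹ = (xs 0)⁻¹ + ∑ i ∈ Finset.range n, c i := by
        intro n
        induction n with
        | zero => simp
        | succ k ih =>
          rw [Finset.sum_range_succ, ← add_assoc, ← ih, (hx k).2, inv_div, add_div,
            mul_div_cancel_right₀ _ (hne k), one_div, add_comm]
      have h3 : Tendsto (fun n => |(xs n)⁻¹|) atTop atTop := by
        refine tendsto_atTop_mono (fun n => ?_) (tendsto_atTop_add_const_right _ (-|(xs 0)⁻¹|) hS)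
        rw [hf n]
        have := abs_sub (((xs 0)⁻¹ + ∑ i ∈ Finset.range n, c i)) ((xs 0)⁻¹)
        rw [add_sub_cancel_left] at this
        linarith
      have h4 := h3.inv_tendsto_atTop
      rw [tendsto_zero_iff_abs_tendsto_zero]
      refine h4.congr (fun n => ?_)
      simp [abs_inv]
  · refine ⟨1, one_pos, fun α hα => ?_⟩
    obtain ⟨n, hn⟩ := (hS.eventually_gt_atTop (1 / α + 1)).exists
    set S : ℕ → ℝ := fun k => ∑ i ∈ Finset.range k, c i with hSd
    change 1 / α + 1 < |S n| at hn
    obtain ⟨t, ht, ht0, ht1⟩ := ((Set.countable_range (fun k => S n - S k)).dense_compl ℝ).exists_between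
      (zero_lt_one (α := ℝ))
    have hne : ∀ k, t - S n + S k ≠ 0 := fun k h => ht ⟨k, by simp only; linarith⟩
    refine ⟨(t - S n)⁻¹, ?_, fun k => (t - S n + S k)⁻¹, ?_, by simp [hSd], n, ?_⟩
    · have : 1 / α < |t - S n| := by
        have := abs_sub t (t - S n)
        rw [sub_sub_cancel, abs_of_pos ht0] at this
        linarith
      rw [abs_inv]
      have h5 : 0 < 1 / α := by positivity
      have := inv_strictAnti₀ h5 this
      simpa using this
    · intro k
      have hs : S (k+1) = S k + c k := Finset.sum_range_succ _ _
      have e : c k * (t - S n + S k)⁻¹ + 1 = (t - S n + S (k+1)) / (t - S n + S k) := by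
        rw [hs]
        have := hne k
        field_simp
        ring
      simp only
      rw [e]
      refine ⟨div_ne_zero (hne _) (hne _), ?_⟩
      have h1 := hne k
      have h2 := hne (k+1)
      field_simp
    · simp only [sub_add_cancel]
      rw [abs_inv, abs_of_pos ht0]
      exact (one_le_inv₀ ht0).2 ht1.le
end

section
/- Let (c_n)_{n≥0} be a real sequence with c_n ≠ 0 for all n such that the series Σ_{n≥0} c_n converges, with sum s. Then every solution (x_n)_{n≥0} of x_{n+1} = x_n/(c_n x_n + 1) with x_0·s + 1 ≠ 0 satisfies lim_{n→∞} x_n = x_0/(x_0·s + 1); in particular, if s = 0 then x_n → x_0. -/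
open Filter in
/-- if the series `Σ c_n` converges with sum `s`, every solution with
`x₀ s + 1 ≠ 0` converges to `x₀/(x₀ s + 1)`; in particular `x_n → x₀` when `s = 0`. -/
theorem stmt19 (c : ℕ → ℝ) (hc : ∀ n, c n ≠ 0) (s : ℝ)
    (hs : Tendsto (fun n => ∑ i ∈ Finset.range n, c i) atTop (nhds s)) :
    ∀ xs : ℕ → ℝ, IsSolC c xs → xs 0 * s + 1 ≠ 0 →
      Tendsto xs atTop (nhds (xs 0 / (xs 0 * s + 1))) ∧
      (s = 0 → Tendsto xs atTop (nhds (xs 0))) := by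
  intro xs hx h0
  have key : ∀ n, xs 0 * (∑ i ∈ Finset.range n, c i) + 1 ≠ 0 ∧
      xs n = xs 0 / (xs 0 * (∑ i ∈ Finset.range n, c i) + 1) := by
    intro n
    induction n with
    | zero => simp
    | succ k ih =>
      obtain ⟨hD, hk⟩ := ih
      obtain ⟨h1, h2⟩ := hx k
      rw [Finset.sum_range_succ]
      generalize (∑ i ∈ Finset.range k, c i) = S at *
      have e : c k * xs k + 1 = (xs 0 * (S + c k) + 1) / (xs 0 * S + 1) := by
        rw [hk]
        field_simp
        ring
      have h3 : xs 0 * (S + c k) + 1 ≠ 0 := by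
        intro h
        apply h1
        rw [e, h, zero_div]
      refine ⟨h3, ?_⟩
      rw [h2, e, hk]
      field_simp
  have main : Tendsto xs atTop (nhds (xs 0 / (xs 0 * s + 1))) := by
    have := (tendsto_const_nhds (x := xs 0)).div ((hs.const_mul (xs 0)).add_const 1) h0
    exact this.congr (fun n => (key n).2.symm)
  refine ⟨main, ?_⟩
  intro h
  simpa [h] using main
end
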